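/- The map ad e : g_d → g_{d+2} is injective for every d ≤ −1 if and only if it is surjective (i.e. g_{d+2} = [e, g_d]) for every d ≥ −1. In other words, for e ∈ g_2 the two defining conditions GG2 and GG3 of a good grading are equivalent. -/

import Mathlib

theorem stmt4_orth (L : Type*) [LieRing L] [LieAlgebra ℂ L] [FiniteDimensional ℂ L]
    (g : ℤ → Submodule ℂ L)
    (hdecomp : DirectSum.IsInternal g)
    (hbracket : ∀ c d : ℤ, ∀ x ∈ g c, ∀ y ∈ g d, ⁅x, y⁆ ∈ g (c + d))
    (c d : ℤ) (h : c + d ≠ 0) (x : L) (hx : x ∈ g c) (y : L) (hy : y ∈ g d) :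
    killingForm ℂ L x y = 0 := by
  rw [killingForm_apply_apply]
  refine LinearMap.trace_eq_zero_of_mapsTo_ne hdecomp (fun i => c + (d + i))
    (fun i => by omega) ?_
  intro i z hz
  exact hbracket _ _ _ hx _ (hbracket _ _ _ hy _ hz)

theorem stmt4_nondeg (L : Type*) [LieRing L] [LieAlgebra ℂ L] [FiniteDimensional ℂ L]
    [LieAlgebra.IsSemisimple ℂ L]
    (g : ℤ → Submodule ℂ L)
    (hdecomp : DirectSum.IsInternal g)
    (hbracket : ∀ c d : ℤ, ∀ x ∈ g c, ∀ y ∈ g d, ⁅x, y⁆ ∈ g (c + d))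
    (c : ℤ) (x : L) (hx : x ∈ g c) (h : ∀ y ∈ g (-c), killingForm ℂ L x y = 0) :
    x = 0 := by
  have hk : LinearMap.ker (killingForm ℂ L) = ⊥ := LieAlgebra.IsKilling.ker_killingForm_eq_bot ℂ L
  rw [← Submodule.mem_bot (R := ℂ), ← hk, LinearMap.mem_ker]
  ext y
  have hy : y ∈ ⨆ i, g i := by rw [hdecomp.submodule_iSup_eq_top]; trivial
  induction hy using Submodule.iSup_induction' with
  | mem i y hy =>
    by_cases hi : c + i = 0
    · obtain rfl : i = -c := by omega
      exact h y hy
    · exact stmt4_orth L g hdecomp hbracket c i hi x hx y hy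
  | zero => simp
  | add a b _ _ ha hb => rw [map_add, ha, hb]; simp

theorem stmt4_proj (L : Type*) [LieRing L] [LieAlgebra ℂ L] [FiniteDimensional ℂ L]
    (g : ℤ → Submodule ℂ L)
    (hdecomp : DirectSum.IsInternal g)
    (hbracket : ∀ c d : ℤ, ∀ x ∈ g c, ∀ y ∈ g d, ⁅x, y⁆ ∈ g (c + d))
    (c : ℤ) (z : L) :
    ∃ z' ∈ g (-c), ∀ w ∈ g c, killingForm ℂ L z w = killingForm ℂ L z' w := by
  have hz : z ∈ ⨆ i, g i := by rw [hdecomp.submodule_iSup_eq_top]; trivial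
  induction hz using Submodule.iSup_induction' with
  | mem i y hy =>
    by_cases hi : i + c = 0
    · obtain rfl : i = -c := by omega
      exact ⟨y, hy, fun _ _ => rfl⟩
    · refine ⟨0, zero_mem _, fun w hw => ?_⟩
      rw [stmt4_orth L g hdecomp hbracket i c hi y hy w hw]; simp
  | zero => exact ⟨0, zero_mem _, fun _ _ => rfl⟩
  | add a b _ _ ha hb =>
    obtain ⟨a', ha, ha'⟩ := ha
    obtain ⟨b', hb, hb'⟩ := hb
    refine ⟨a' + b', add_mem ha hb, fun w hw => ?_⟩
    simp only [map_add, LinearMap.add_apply, ha' w hw, hb' w hw]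


/-- For a ℤ-graded finite-dimensional complex semisimple Lie algebra
and `e ∈ g₂`, the map `ad e : g_d → g_{d+2}` is injective for every `d ≤ −1` iff it is
surjective for every `d ≥ −1`; i.e. conditions GG2 and GG3 of a good grading are
equivalent. -/
theorem stmt4 (L : Type*) [LieRing L] [LieAlgebra ℂ L] [FiniteDimensional ℂ L]
    [LieAlgebra.IsSemisimple ℂ L]
    (g : ℤ → Submodule ℂ L)
    (hdecomp : DirectSum.IsInternal g)
    (hfin : {d : ℤ | g d ≠ ⊥}.Finite)
    (hbracket : ∀ c d : ℤ, ∀ x ∈ g c, ∀ y ∈ g d, ⁅x, y⁆ ∈ g (c + d))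
    (e : L) (he : e ∈ g 2) :
    (∀ d : ℤ, d ≤ -1 → ∀ x ∈ g d, ⁅e, x⁆ = 0 → x = 0) ↔
      (∀ d : ℤ, -1 ≤ d → ∀ y ∈ g (d + 2), ∃ x ∈ g d, ⁅e, x⁆ = y) := by
  constructor
  · intro hinj d hd y hy
    have hrefl : (killingForm ℂ L).IsRefl := (LieModule.traceForm_isSymm ℂ L L).isRefl
    have hnd : (killingForm ℂ L).Nondegenerate := LieAlgebra.IsKilling.killingForm_nondegenerate ℂ L
    suffices hW : y ∈ (g d).map (LieAlgebra.ad ℂ L e) by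
      obtain ⟨x, hx, hxy⟩ := hW
      exact ⟨x, hx, hxy⟩
    rw [← LinearMap.BilinForm.orthogonal_orthogonal hnd hrefl ((g d).map (LieAlgebra.ad ℂ L e))]
    rw [LinearMap.BilinForm.mem_orthogonal_iff]
    intro z hz
    rw [LinearMap.BilinForm.mem_orthogonal_iff] at hz
    obtain ⟨z', hz', hzz⟩ := stmt4_proj L g hdecomp hbracket (d + 2) z
    have h0 : z' = 0 := by
      refine hinj (-(d + 2)) (by omega) z' hz' ?_
      have hez := hbracket _ _ _ he _ hz'
      refine stmt4_nondeg L g hdecomp hbracket _ _ hez ?_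
      intro x hx
      rw [show -(2 + -(d + 2)) = d by ring] at hx
      have h1 : killingForm ℂ L ⁅e, x⁆ z = 0 := hz _ ⟨x, hx, rfl⟩
      have h2 := hzz ⁅e, x⁆ (by rw [add_comm]; exact hbracket _ _ _ he _ hx)
      rw [LieModule.traceForm_comm, h1] at h2
      rw [LieModule.traceForm_apply_lie_apply', ← h2, neg_zero]
    show killingForm ℂ L z y = 0
    rw [hzz y hy, h0]; simp
  · intro hsurj d hd x hx hex
    refine stmt4_nondeg L g hdecomp hbracket d x hx ?_
    intro y hy
    obtain ⟨w, hw, rfl⟩ := hsurj (-d - 2) (by omega) y (by simpa using hy)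
    rw [← LieModule.traceForm_apply_lie_apply, ← lie_skew, hex]; simp
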